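/- In a finite episodic MDP with rewards in [0,1], for any two stagewise policies π and π', the performance difference satisfies J(π) − J(π') ≤ 2H·Σ_{h=1}^H E_{s∼d_h^π}[TV(π(·|s,h), π'(·|s,h))]. -/

import Mathlib

open Finset

namespace RCSL

noncomputable section

/-- Real-valued indicator of a proposition. -/
def ind (P : Prop) : ℝ :=
  haveI := Classical.propDecidable P
  if P then 1 else 0

/-- A finite (possibly stochastic) episodic MDP with horizon `H`.  Stages are 0-indexed
(`0, …, H-1` here corresponds to the paper's stages `1, …, H`). -/
structure FinMDP (S A : Type) [Fintype S] [Fintype A] (H : ℕ) where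
  /-- stochastic transition kernel: `P h s a s'` is the probability of moving to `s'` -/
  P : ℕ → S → A → S → ℝ
  P_nonneg : ∀ h s a s', 0 ≤ P h s a s'
  P_sum_one : ∀ h s a, ∑ s', P h s a s' = 1
  /-- deterministic reward function -/
  r : ℕ → S → A → ℝ
  r_nonneg : ∀ h s a, 0 ≤ r h s a
  r_le_one : ∀ h s a, r h s a ≤ 1
  /-- initial state distribution -/
  ρ : S → ℝ
  ρ_nonneg : ∀ s, 0 ≤ ρ s
  ρ_sum_one : ∑ s, ρ s = 1

/-- Stagewise weight functions on actions; genuine policies are those satisfying `IsPolicy`. -/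
abbrev Pol (S A : Type) := ℕ → S → A → ℝ

variable {S A : Type} [Fintype S] [Fintype A] [Nonempty S] [Nonempty A] {H : ℕ}

/-- `π` is a genuine stagewise policy: at every stage and state it is a probability
distribution on actions. -/
def IsPolicy (π : Pol S A) : Prop :=
  (∀ h s a, 0 ≤ π h s a) ∧ ∀ h s, ∑ a, π h s a = 1

/-- The total variation distance between two (finitely supported) distributions on `A`. -/
def tv (p q : A → ℝ) : ℝ :=
  (∑ a, |p a - q a|) / 2

/-- Length-`H` trajectories: a state–action pair at every stage. -/
abbrev Traj (S A : Type) (H : ℕ) := Fin H → S × A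

/-- The state of trajectory `τ` at (0-indexed) stage `h`. -/
def stAt (τ : Traj S A H) (h : ℕ) : S :=
  if hh : h < H then (τ ⟨h, hh⟩).1 else Classical.arbitrary S

/-- The action of trajectory `τ` at (0-indexed) stage `h`. -/
def actAt (τ : Traj S A H) (h : ℕ) : A :=
  if hh : h < H then (τ ⟨h, hh⟩).2 else Classical.arbitrary A

/-- The probability `P_β(τ)` of trajectory `τ` when the initial state is drawn from `ρ`,
actions are drawn from the policy `β`, and states follow the transition kernels. -/
def trajProb (M : FinMDP S A H) (β : Pol S A) (τ : Traj S A H) : ℝ :=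
  (if 0 < H then M.ρ (stAt τ 0) else 1) *
    (∏ h : Fin H, β h (stAt τ h) (actAt τ h)) *
    ∏ h : Fin H, (if (h : ℕ) + 1 < H then
      M.P h (stAt τ h) (actAt τ h) (stAt τ ((h : ℕ) + 1)) else 1)

/-- The return-to-go `g_h(τ) = Σ_{t ≥ h} r_t(s_t, a_t)` of trajectory `τ` from stage `h`. -/
def rtg (M : FinMDP S A H) (h : ℕ) (τ : Traj S A H) : ℝ :=
  ∑ t : Fin H, if h ≤ (t : ℕ) then M.r t (stAt τ t) (actAt τ t) else 0

/-- The stage-`h` state occupancy measure `d_h^π` of policy `π`. -/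
def occ (M : FinMDP S A H) (π : Pol S A) : ℕ → S → ℝ
  | 0 => M.ρ
  | n + 1 => fun s' => ∑ s, ∑ a, occ M π n s * π n s a * M.P n s a s'

/-- The expected total reward `J(π)` of policy `π`. -/
def J (M : FinMDP S A H) (π : Pol S A) : ℝ :=
  ∑ h ∈ Finset.range H, ∑ s, ∑ a, occ M π h s * π h s a * M.r h s a

/-- The conditional action probability `P_β(a_h = a ∣ s_h = s, g_h = g)`. -/
def condA (M : FinMDP S A H) (β : Pol S A) (h : ℕ) (s : S) (g : ℝ) (a : A) : ℝ :=
  (∑ τ : Traj S A H, trajProb M β τ * ind (stAt τ h = s ∧ actAt τ h = a ∧ rtg M h τ = g)) /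
    ∑ τ : Traj S A H, trajProb M β τ * ind (stAt τ h = s ∧ rtg M h τ = g)

/-- The in-distribution optimal return-to-go `f⋆(s, h)`. -/
def fstar (M : FinMDP S A H) (β : Pol S A) (s : S) (h : ℕ) : ℝ :=
  sSup {g : ℝ | ∃ τ : Traj S A H, 0 < trajProb M β τ ∧ stAt τ h = s ∧ rtg M h τ = g}

/-- The in-distribution optimal stitched policy `π⋆_β`. -/
def piStar (M : FinMDP S A H) (β : Pol S A) : Pol S A :=
  fun h s a => condA M β h s (fstar M β s h) a

/-- Probability that an i.i.d. dataset of `N` trajectories drawn from `P_β` satisfies `E`. -/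
def datasetProb (M : FinMDP S A H) (β : Pol S A) (N : ℕ)
    (E : (Fin N → Traj S A H) → Prop) : ℝ :=
  ∑ D : Fin N → Traj S A H, (∏ k, trajProb M β (D k)) * ind (E D)

/-- The population loss
`L(π) = Σ_h E_{τ∼P_β}[log (P_β(a_h ∣ s_h, h, g_h) / π(a_h ∣ s_h, h, g_h))]`, i.e. the
expected Kullback–Leibler divergence `E_{(s,g)∼P_β}[KL(P_β(·∣s,g) ‖ π(·∣s,g))]` summed over
stages. -/
def popLoss (M : FinMDP S A H) (β : Pol S A) (π : ℕ → S → ℝ → A → ℝ) : ℝ :=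
  ∑ h ∈ Finset.range H, ∑ τ : Traj S A H, trajProb M β τ *
    Real.log (condA M β h (stAt τ h) (rtg M h τ) (actAt τ h) /
      π h (stAt τ h) (rtg M h τ) (actAt τ h))

/-- The empirical negative log-likelihood
`Σ_{τ ∈ D} Σ_h −log π(a_h ∣ s_h, h, g_h(τ))`. -/
def empNLL (M : FinMDP S A H) {N : ℕ} (D : Fin N → Traj S A H)
    (π : ℕ → S → ℝ → A → ℝ) : ℝ :=
  ∑ k, ∑ h ∈ Finset.range H, -Real.log (π h (stAt (D k) h) (rtg M h (D k)) (actAt (D k) h))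

end

end RCSL

namespace RCSL

section PerformanceDifference

variable {S A : Type} [Fintype S] [Fintype A] {H : ℕ}

theorem occ_nonneg (M : FinMDP S A H) {π : Pol S A} (hπ : IsPolicy π) (h : ℕ) (s : S) :
    0 ≤ occ M π h s := by
  induction h generalizing s with
  | zero => exact M.ρ_nonneg s
  | succ n ih =>
    exact Finset.sum_nonneg fun s _ => Finset.sum_nonneg fun a _ =>
      mul_nonneg (mul_nonneg (ih s) (hπ.1 n s a)) (M.P_nonneg n s a _)

theorem tv_nonneg (p q : A → ℝ) : 0 ≤ tv p q :=
  div_nonneg (Finset.sum_nonneg fun _ _ => abs_nonneg _) zero_le_two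

/-- The `ℓ¹` distance between state-action occupancies exceeds that between state occupancies
by at most twice the expected total variation distance between the policies. -/
theorem sum_abs_stateAction_sub_le (M : FinMDP S A H) {π π' : Pol S A} (hπ : IsPolicy π)
    (hπ' : IsPolicy π') (h : ℕ) :
    ∑ s, ∑ a, |occ M π h s * π h s a - occ M π' h s * π' h s a| ≤
      ∑ s, |occ M π h s - occ M π' h s| + 2 * ∑ s, occ M π h s * tv (π h s) (π' h s) := by
  rw [Finset.mul_sum, ← Finset.sum_add_distrib]
  refine Finset.sum_le_sum fun s _ => ?_
  calc ∑ a, |occ M π h s * π h s a - occ M π' h s * π' h s a|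
      ≤ ∑ a, (|occ M π h s - occ M π' h s| * π' h s a +
          occ M π h s * |π h s a - π' h s a|) := by
        refine Finset.sum_le_sum fun a _ => ?_
        rw [show occ M π h s * π h s a - occ M π' h s * π' h s a =
          (occ M π h s - occ M π' h s) * π' h s a + occ M π h s * (π h s a - π' h s a) by ring]
        refine (abs_add_le _ _).trans_eq ?_
        rw [abs_mul, abs_mul, abs_of_nonneg (hπ'.1 h s a), abs_of_nonneg (occ_nonneg M hπ h s)]
    _ = |occ M π h s - occ M π' h s| + 2 * (occ M π h s * tv (π h s) (π' h s)) := by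
        rw [Finset.sum_add_distrib, ← Finset.mul_sum, ← Finset.mul_sum, hπ'.2 h s, tv]
        ring

/-- Applying the transition kernel does not increase the `ℓ¹` distance. -/
theorem sum_abs_occ_succ_sub_le (M : FinMDP S A H) (π π' : Pol S A) (h : ℕ) :
    ∑ s, |occ M π (h + 1) s - occ M π' (h + 1) s| ≤
      ∑ s, ∑ a, |occ M π h s * π h s a - occ M π' h s * π' h s a| := by
  calc ∑ s', |occ M π (h + 1) s' - occ M π' (h + 1) s'|
      ≤ ∑ s', ∑ s, ∑ a,
          |occ M π h s * π h s a - occ M π' h s * π' h s a| * M.P h s a s' := by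
        refine Finset.sum_le_sum fun s' _ => ?_
        simp only [occ, ← Finset.sum_sub_distrib, ← sub_mul]
        refine (Finset.abs_sum_le_sum_abs _ _).trans (Finset.sum_le_sum fun s _ => ?_)
        refine (Finset.abs_sum_le_sum_abs _ _).trans (Finset.sum_le_sum fun a _ => ?_)
        rw [abs_mul, abs_of_nonneg (M.P_nonneg h s a s')]
    _ = ∑ s, ∑ a, |occ M π h s * π h s a - occ M π' h s * π' h s a| := by
        rw [Finset.sum_comm]
        refine Finset.sum_congr rfl fun s _ => ?_
        rw [Finset.sum_comm]
        refine Finset.sum_congr rfl fun a _ => ?_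
        rw [← Finset.mul_sum, M.P_sum_one, mul_one]

theorem sum_abs_occ_sub_le (M : FinMDP S A H) {π π' : Pol S A} (hπ : IsPolicy π)
    (hπ' : IsPolicy π') (h : ℕ) :
    ∑ s, |occ M π h s - occ M π' h s| ≤
      2 * ∑ t ∈ Finset.range h, ∑ s, occ M π t s * tv (π t s) (π' t s) := by
  induction h with
  | zero => simp [occ]
  | succ n ih =>
    rw [Finset.sum_range_succ]
    linarith [sum_abs_occ_succ_sub_le M π π' n, sum_abs_stateAction_sub_le M hπ hπ' n]

end PerformanceDifference

/-- In a finite episodic MDP with rewards in `[0,1]`, for any two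
stagewise policies `π` and `π'`, the performance difference satisfies
`J(π) − J(π') ≤ 2H·Σ_{h=1}^H E_{s∼d_h^π}[TV(π(·∣s,h), π'(·∣s,h))]`. -/
theorem stmt9 {S A : Type} [Fintype S] [Fintype A] [Nonempty S] [Nonempty A] {H : ℕ}
    (M : FinMDP S A H) (π π' : Pol S A) (hπ : IsPolicy π) (hπ' : IsPolicy π') :
    J M π - J M π' ≤
      2 * H * ∑ h ∈ Finset.range H, ∑ s, occ M π h s * tv (π h s) (π' h s) := by
  have hstage : ∀ h ∈ Finset.range H,
      ∑ s, ∑ a, occ M π h s * π h s a * M.r h s a -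
        ∑ s, ∑ a, occ M π' h s * π' h s a * M.r h s a ≤
      2 * ∑ t ∈ Finset.range H, ∑ s, occ M π t s * tv (π t s) (π' t s) := by
    intro h hh
    have hreward : ∑ s, ∑ a, occ M π h s * π h s a * M.r h s a -
          ∑ s, ∑ a, occ M π' h s * π' h s a * M.r h s a ≤
        ∑ s, ∑ a, |occ M π h s * π h s a - occ M π' h s * π' h s a| := by
      simp only [← Finset.sum_sub_distrib, ← sub_mul]
      refine Finset.sum_le_sum fun s _ => Finset.sum_le_sum fun a _ => ?_
      exact (mul_le_mul_of_nonneg_right (le_abs_self _) (M.r_nonneg h s a)).trans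
        (mul_le_of_le_one_right (abs_nonneg _) (M.r_le_one h s a))
    have hmono : ∑ t ∈ Finset.range (h + 1), ∑ s, occ M π t s * tv (π t s) (π' t s) ≤
        ∑ t ∈ Finset.range H, ∑ s, occ M π t s * tv (π t s) (π' t s) :=
      Finset.sum_le_sum_of_subset_of_nonneg
        (Finset.range_subset_range.2 (Finset.mem_range.1 hh))
        fun t _ _ => Finset.sum_nonneg fun s _ =>
          mul_nonneg (occ_nonneg M hπ t s) (tv_nonneg _ _)
    rw [Finset.sum_range_succ] at hmono
    linarith [sum_abs_stateAction_sub_le M hπ hπ' h, sum_abs_occ_sub_le M hπ hπ' h]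
  rw [J, J, ← Finset.sum_sub_distrib]
  refine (Finset.sum_le_sum hstage).trans (le_of_eq ?_)
  rw [Finset.sum_const, Finset.card_range, nsmul_eq_mul]
  ring

end RCSL
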